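/- Let p ≡ 3 (mod 4) be a prime and let p ≡ ±2 (mod 5). For the elliptic curve E_{−p}: y² = x(x² − px − p²) over ℚ (the −p quadratic twist of y² = x(x² + x − 1)) with 2-isogenous curve E′_{−p}: y² = x(x² + 2px + 5p²), both descent images φ(E′_{−p}(ℚ)) ⊆ ℚ^×/(ℚ^×)² and φ′(E_{−p}(ℚ)) ⊆ ℚ^×/(ℚ^×)² have exactly 2 elements; consequently the Mordell–Weil rank of E_{−p}(ℚ) is 0. -/

import Mathlib

/-- The subgroup of squares in `ℚˣ`. -/
def QSq : Subgroup ℚˣ := (powMonoidHom 2 : ℚˣ →* ℚˣ).range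

/-- The class of a nonzero rational number in `ℚˣ/(ℚˣ)²` (junk value `1` at `0`). -/
noncomputable def sqClass (x : ℚ) : ℚˣ ⧸ QSq :=
  if h : x = 0 then 1 else QuotientGroup.mk (Units.mk0 x h)

/-! ### Squares in `ℤ` and `ℚ` -/

lemma Int.isSquare_of_isSquare_sq_mul {c K : ℤ} (hc : c ≠ 0) (h : IsSquare (c ^ 2 * K)) :
    IsSquare K := by
  obtain ⟨z, hz⟩ := h
  rw [← Rat.isSquare_intCast_iff]
  refine ⟨z / c, ?_⟩
  have hc' : (c : ℚ) ≠ 0 := by exact_mod_cast hc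
  have hz' : (c : ℚ) ^ 2 * K = z * z := by exact_mod_cast hz
  field_simp
  linear_combination hz'

lemma Int.isSquare_or_isSquare_neg_of_isCoprime {a b : ℤ} (hab : IsCoprime a b)
    (h : IsSquare (a * b)) : IsSquare a ∨ IsSquare (-a) := by
  obtain ⟨z, hz⟩ := h
  obtain ⟨c, hc | hc⟩ := Int.sq_of_gcd_eq_one (Int.isCoprime_iff_gcd_eq_one.mp hab)
    (hz.trans (sq z).symm)
  · exact .inl ⟨c, by rw [hc, sq]⟩
  · exact .inr ⟨c, by rw [hc, neg_neg, sq]⟩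

lemma Int.isSquare_of_isCoprime_of_pos {a b : ℤ} (hab : IsCoprime a b) (ha : 0 < a)
    (h : IsSquare (a * b)) : IsSquare a :=
  (Int.isSquare_or_isSquare_neg_of_isCoprime hab h).resolve_right fun hn => by
    have := hn.nonneg
    lia

/-- The numerator and denominator of the `x`-coordinate of a rational point on
`y² = x³ + A x² + B x` with integral coefficients. -/
lemma isSquare_den_and_isSquare_of_equation {A B : ℤ} {x y : ℚ}
    (h : y ^ 2 = x ^ 3 + A * x ^ 2 + B * x) :
    IsSquare (x.den : ℤ) ∧
      IsSquare (x.num * (x.num ^ 2 + A * x.num * x.den + B * (x.den : ℤ) ^ 2)) := by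
  obtain ⟨r, s, hr, hs⟩ : ∃ r s : ℤ, r = x.num ∧ s = x.den := ⟨_, _, rfl, rfl⟩
  have hcop : IsCoprime r s := hr ▸ hs ▸ x.isCoprime_num_den
  have hx : x * s = r := by rw [hr, hs]; exact_mod_cast Rat.mul_den_eq_num x
  have hspos : 0 < s := by rw [hs]; exact_mod_cast x.den_pos
  rw [← hr, ← hs]
  have hprod : IsSquare (s * (r * (r ^ 2 + A * r * s + B * s ^ 2))) := by
    rw [← Rat.isSquare_intCast_iff]
    refine ⟨y * s ^ 2, ?_⟩
    push_cast
    rw [← hx]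
    linear_combination (-(s : ℚ) ^ 4) * h
  have hcop' : IsCoprime s (r * (r ^ 2 + A * r * s + B * s ^ 2)) := by
    refine hcop.symm.mul_right ?_
    have : r ^ 2 + A * r * s + B * s ^ 2 = r ^ 2 + s * (A * r + B * s) := by ring
    rw [this]
    exact (hcop.symm.pow_right).add_mul_left_right _
  have hsq := Int.isSquare_of_isCoprime_of_pos hcop' hspos hprod
  refine ⟨hsq, ?_⟩
  obtain ⟨e, he⟩ := hsq
  refine Int.isSquare_of_isSquare_sq_mul (c := e) (by rintro rfl; lia) ?_
  rwa [sq, ← he]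

lemma Rat.isSquare_mul_of_isSquare_num {c : ℤ} {x : ℚ} (hd : IsSquare (x.den : ℤ))
    (hn : IsSquare (c * x.num)) : IsSquare ((c : ℚ) * x) := by
  have h : (c : ℚ) * x = ((c * x.num : ℤ) : ℚ) / ((x.den : ℤ) : ℚ) := by
    push_cast
    rw [mul_div_assoc, Rat.num_div_den]
  rw [h]
  exact (Rat.isSquare_intCast_iff.mpr hn).div (Rat.isSquare_intCast_iff.mpr hd)

/-! ### Non-divisibility by primes inert in `ℚ(√5)` or `ℚ(i)` -/

lemma not_dvd_of_not_isSquare_five {p : ℕ} [Fact p.Prime] (h5 : p % 5 = 2 ∨ p % 5 = 3)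
    (h2 : p ≠ 2) {r s : ℤ} (hs : ¬ (p : ℤ) ∣ s) : ¬ (p : ℤ) ∣ r ^ 2 - r * s - s ^ 2 := by
  intro h
  have hns : ¬ IsSquare (p : ZMod 5) := by
    rw [← ZMod.natCast_mod]
    rcases h5 with h | h <;> rw [h] <;> decide
  have := Fact.mk Nat.prime_five
  rw [ZMod.exists_sq_eq_prime_iff_of_mod_four_eq_one (p := 5) (q := p) (by norm_num) h2] at hns
  rw [← ZMod.intCast_zmod_eq_zero_iff_dvd] at h hs
  push_cast at h
  refine hns ⟨(2 * r - s) / s, ?_⟩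
  push_cast
  field_simp
  linear_combination -4 * h

lemma not_dvd_sq_add_two_mul_add_five_sq {p : ℕ} [Fact p.Prime] (h4 : p % 4 = 3) {r s : ℤ}
    (hs : ¬ (p : ℤ) ∣ s) : ¬ (p : ℤ) ∣ r ^ 2 + 2 * r * s + 5 * s ^ 2 := by
  intro h
  rw [← ZMod.intCast_zmod_eq_zero_iff_dvd] at h hs
  push_cast at h
  have h2 : (2 : ZMod p) ≠ 0 := by
    intro h2
    have : (p : ℕ) ∣ 2 := (ZMod.natCast_eq_zero_iff 2 p).mp (by exact_mod_cast h2)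
    have := Nat.le_of_dvd (by norm_num) this
    lia
  refine ZMod.mod_four_ne_three_of_sq_eq_neg_sq' (p := p) (x := (r : ZMod p) + s)
    (mul_ne_zero h2 hs) ?_ h4
  linear_combination h

/-! ### The two descent images -/

lemma isSquare_or_isSquare_neg_of_equation {p : ℕ} (hp : p.Prime) (h4 : p % 4 = 3)
    (h5 : p % 5 = 2 ∨ p % 5 = 3) {x y : ℚ}
    (h : y ^ 2 = x ^ 3 - (p : ℚ) * x ^ 2 - (p : ℚ) ^ 2 * x) : IsSquare x ∨ IsSquare (-x) := by
  have := Fact.mk hp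
  have hpp : Prime (p : ℤ) := Nat.prime_iff_prime_int.mp hp
  obtain ⟨hden, hnum⟩ := isSquare_den_and_isSquare_of_equation (A := -p) (B := -p ^ 2)
    (x := x) (y := y) (by push_cast; linear_combination h)
  have hcop := x.isCoprime_num_den
  suffices IsSquare x.num ∨ IsSquare (-x.num) by
    refine this.imp (fun hn => ?_) fun hn => ?_
    · simpa using Rat.isSquare_mul_of_isSquare_num (c := 1) hden (by simpa using hn)
    · simpa using Rat.isSquare_mul_of_isSquare_num (c := -1) hden (by simpa using hn)
  generalize x.num = r at *
  generalize (x.den : ℤ) = s at *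
  by_cases hpr : (p : ℤ) ∣ r
  · obtain ⟨t, rfl⟩ := hpr
    have hps : ¬ (p : ℤ) ∣ s := fun hd =>
      hpp.not_isUnit (hcop.isUnit_of_dvd' (dvd_mul_right _ _) hd)
    have hq := not_dvd_of_not_isSquare_five h5 (by lia) (r := t) hps
    refine Int.isSquare_or_isSquare_neg_of_isCoprime (b := t ^ 2 - t * s - s ^ 2) ?_ ?_
    · refine ((hpp.coprime_iff_not_dvd).mpr hq).mul_left ?_
      have : t ^ 2 - t * s - s ^ 2 = -s ^ 2 + t * (t - s) := by ring
      rw [this]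
      exact (hcop.of_mul_left_right.pow_right.neg_right).add_mul_left_right _
    · refine Int.isSquare_of_isSquare_sq_mul (c := p) hpp.ne_zero ?_
      convert hnum using 1
      ring
  · refine Int.isSquare_or_isSquare_neg_of_isCoprime ?_ hnum
    have : r ^ 2 + -(p : ℤ) * r * s + -(p : ℤ) ^ 2 * s ^ 2
        = -((p : ℤ) * s) ^ 2 + r * (r - p * s) := by ring
    rw [this]
    exact ((((hpp.coprime_iff_not_dvd).mpr hpr).symm.mul_right hcop).pow_right.neg_right
      ).add_mul_left_right _

/-- If `c r (r² + 2 b r s + 5 b² s²)` is a square with `c r` positive, `c` coprime to the quadratic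
form and `r` coprime to `b s`, then `c r` or `5 c r` is a square. -/
lemma isSquare_or_isSquare_five_mul {b c r s : ℤ} (hpos : 0 < c * r)
    (hcop : IsCoprime r (b * s)) (hc : IsCoprime c (r ^ 2 + 2 * b * r * s + 5 * b ^ 2 * s ^ 2))
    (h : IsSquare (c * r * (r ^ 2 + 2 * b * r * s + 5 * b ^ 2 * s ^ 2))) :
    IsSquare (c * r) ∨ IsSquare (5 * (c * r)) := by
  have h5 : Prime (5 : ℤ) := by norm_num
  by_cases hr : (5 : ℤ) ∣ r
  · obtain ⟨t, rfl⟩ := hr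
    right
    have hsq : IsSquare (c * t) := by
      have hf : (5 * t) ^ 2 + 2 * b * (5 * t) * s + 5 * b ^ 2 * s ^ 2
        = 5 * ((b * s) ^ 2 + t * (5 * t + 2 * b * s)) := by ring
      rw [hf] at hc h
      refine Int.isSquare_of_isCoprime_of_pos (b := (b * s) ^ 2 + t * (5 * t + 2 * b * s))
        ?_ (by linarith) ?_
      · exact hc.of_mul_right_right.mul_left
          (hcop.of_mul_left_right.pow_right.add_mul_left_right _)
      · refine Int.isSquare_of_isSquare_sq_mul (c := 5) (by norm_num) ?_
        convert h using 1
        ring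
    have hf : 5 * (c * (5 * t)) = 5 ^ 2 * (c * t) := by ring
    rw [hf]
    exact (IsSquare.sq 5).mul hsq
  · left
    refine Int.isSquare_of_isCoprime_of_pos (hc.mul_left ?_) hpos h
    have : r ^ 2 + 2 * b * r * s + 5 * b ^ 2 * s ^ 2
        = 5 * (b * s) ^ 2 + r * (r + 2 * b * s) := by ring
    rw [this]
    exact (((h5.coprime_iff_not_dvd).mpr hr).symm.mul_right hcop.pow_right).add_mul_left_right _

lemma isSquare_or_isSquare_five_mul_of_equation {p : ℕ} (hp : p.Prime) (h4 : p % 4 = 3)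
    {x y : ℚ} (hx : x ≠ 0)
    (h : y ^ 2 = x ^ 3 + 2 * (p : ℚ) * x ^ 2 + 5 * (p : ℚ) ^ 2 * x) :
    IsSquare x ∨ IsSquare (5 * x) := by
  have := Fact.mk hp
  have hpp : Prime (p : ℤ) := Nat.prime_iff_prime_int.mp hp
  obtain ⟨hden, hnum⟩ := isSquare_den_and_isSquare_of_equation (A := 2 * p) (B := 5 * p ^ 2)
    (x := x) (y := y) (by push_cast; linear_combination h)
  have hcop := x.isCoprime_num_den
  have hpos : 0 < x.num := by
    rw [Rat.num_pos]
    have hp0 : (0 : ℚ) < p := by exact_mod_cast hp.pos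
    have hq : 0 < (x + p) ^ 2 + 4 * (p : ℚ) ^ 2 := by positivity
    refine lt_of_le_of_ne (nonneg_of_mul_nonneg_left (b := (x + p) ^ 2 + 4 * (p : ℚ) ^ 2) ?_ hq)
      hx.symm
    nlinarith [sq_nonneg y]
  suffices IsSquare x.num ∨ IsSquare (5 * x.num) by
    refine this.imp (fun hn => ?_) fun hn => ?_
    · simpa using Rat.isSquare_mul_of_isSquare_num (c := 1) hden (by simpa using hn)
    · simpa using Rat.isSquare_mul_of_isSquare_num (c := 5) hden hn
  generalize x.num = r at *
  generalize (x.den : ℤ) = s at *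
  by_cases hpr : (p : ℤ) ∣ r
  · obtain ⟨t, rfl⟩ := hpr
    have hps : ¬ (p : ℤ) ∣ s := fun hd =>
      hpp.not_isUnit (hcop.isUnit_of_dvd' (dvd_mul_right _ _) hd)
    have hq := not_dvd_sq_add_two_mul_add_five_sq h4 (r := t) hps
    refine isSquare_or_isSquare_five_mul (b := 1) (s := s) hpos ?_ ?_ ?_
    · simpa using hcop.of_mul_left_right
    · simpa using (hpp.coprime_iff_not_dvd).mpr hq
    · refine Int.isSquare_of_isSquare_sq_mul (c := p) hpp.ne_zero ?_
      convert hnum using 1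
      ring
  · simpa using isSquare_or_isSquare_five_mul (b := p) (c := 1) (s := s) (by simpa using hpos)
      (((hpp.coprime_iff_not_dvd).mpr hpr).symm.mul_right hcop) isCoprime_one_left
      (by simpa using hnum)

/-! ### Naive heights -/

/-- The naive multiplicative height `max |r| s` of a rational number `r / s` in lowest terms. -/
def ratHeight (x : ℚ) : ℤ := max |x.num| x.den

lemma one_le_ratHeight (x : ℚ) : 1 ≤ ratHeight x :=
  le_max_of_le_right (by exact_mod_cast x.den_pos)

lemma abs_num_le_ratHeight (x : ℚ) : |x.num| ≤ ratHeight x := le_max_left _ _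

lemma den_le_ratHeight (x : ℚ) : (x.den : ℤ) ≤ ratHeight x := le_max_right _ _

lemma finite_setOf_ratHeight_le (B : ℤ) : {x : ℚ | ratHeight x ≤ B}.Finite := by
  refine Set.Finite.of_injOn (f := fun x : ℚ => (x.num, (x.den : ℤ)))
    (t := Set.Icc (-B) B ×ˢ Set.Icc 0 B) (fun x hx => ?_) (fun x _ y _ hxy => ?_)
    ((Set.finite_Icc _ _).prod (Set.finite_Icc _ _))
  · have h : ratHeight x ≤ B := hx
    exact ⟨abs_le.mp ((abs_num_le_ratHeight x).trans h), by positivity,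
      (den_le_ratHeight x).trans h⟩
  · simp only [Prod.mk.injEq, Nat.cast_inj] at hxy
    exact Rat.ext hxy.1 hxy.2

lemma exists_eq_mul_num_den {z : ℚ} {N D : ℤ} (hD : D ≠ 0) (h : z * D = N) :
    ∃ g : ℤ, N = g * z.num ∧ D = g * z.den := by
  refine Rat.num_den_mk hD ?_
  rw [Rat.divInt_eq_div, eq_div_iff (by exact_mod_cast hD), h]

lemma ratHeight_le_of_mul_eq {z : ℚ} {N D B : ℤ} (hD : D ≠ 0) (h : z * D = N) (hNB : |N| ≤ B)
    (hDB : |D| ≤ B) : ratHeight z ≤ B := by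
  obtain ⟨g, rfl, rfl⟩ := exists_eq_mul_num_den hD h
  have hg : 1 ≤ |g| := Int.one_le_abs (left_ne_zero_of_mul hD)
  rw [abs_mul] at hNB hDB
  rw [Nat.abs_cast] at hDB
  refine max_le (le_trans ?_ hNB) (le_trans ?_ hDB)
  · exact le_mul_of_one_le_left (abs_nonneg _) hg
  · exact le_mul_of_one_le_left (by positivity) hg

lemma ratHeight_intCast_mul_le {c : ℤ} (hc : c ≠ 0) (x : ℚ) :
    ratHeight (c * x) ≤ |c| * ratHeight x := by
  refine ratHeight_le_of_mul_eq (N := c * x.num) (D := x.den) (by exact_mod_cast x.den_ne_zero)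
    ?_ ?_ ?_
  · push_cast
    rw [mul_assoc, Rat.mul_den_eq_num]
  · rw [abs_mul]
    gcongr
    exact abs_num_le_ratHeight x
  · rw [Nat.abs_cast]
    exact (den_le_ratHeight x).trans
      (le_mul_of_one_le_left (by linarith [one_le_ratHeight x]) (Int.one_le_abs hc))

lemma ratHeight_inv_le {x : ℚ} (hx : x ≠ 0) : ratHeight x⁻¹ ≤ ratHeight x := by
  refine ratHeight_le_of_mul_eq (N := x.den) (D := x.num) (Rat.num_ne_zero.mpr hx) ?_ ?_
    (abs_num_le_ratHeight x)
  · rw [inv_mul_eq_iff_eq_mul₀ hx]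
    exact_mod_cast (Rat.mul_den_eq_num x).symm
  · rw [Nat.abs_cast]
    exact den_le_ratHeight x

/-- The degree two map `x ↦ (x² + a x + b) / x` squares heights up to a constant factor. -/
lemma ratHeight_sq_le {a b : ℤ} (hb : b ≠ 0) {x z : ℚ} (hx : x ≠ 0)
    (h : z * x = x ^ 2 + a * x + b) :
    ratHeight x ^ 2 ≤ (2 + |a| + |b|) * |b| * ratHeight z := by
  have hcop := x.isCoprime_num_den
  have hxs : x * x.den = x.num := Rat.mul_den_eq_num x
  have hr0 : x.num ≠ 0 := Rat.num_ne_zero.mpr hx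
  have hs0 : (0 : ℤ) < x.den := by exact_mod_cast x.den_pos
  have hsq : ratHeight x ^ 2 = max (x.num ^ 2) ((x.den : ℤ) ^ 2) := by
    unfold ratHeight
    rcases le_total |x.num| (x.den : ℤ) with hle | hle
    · rw [max_eq_right hle, max_eq_right (sq_le_sq.mpr (by rwa [Nat.abs_cast]))]
    · rw [max_eq_left hle, max_eq_left (sq_le_sq.mpr (by rwa [Nat.abs_cast])), sq_abs]
  obtain ⟨g, hN, hD⟩ := exists_eq_mul_num_den (z := z)
    (N := x.num ^ 2 + a * x.num * x.den + b * (x.den : ℤ) ^ 2) (D := x.num * x.den)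
    (mul_ne_zero hr0 hs0.ne') (by
      push_cast
      rw [← hxs]
      linear_combination (x.den : ℚ) ^ 2 * h)
  rw [hsq]
  have hzn := abs_num_le_ratHeight z
  have hzd := den_le_ratHeight z
  have hz1 := one_le_ratHeight z
  generalize ratHeight z = H at *
  generalize x.num = r at *
  generalize (x.den : ℤ) = s at *
  have hgs : IsCoprime g s := by
    have h1 : IsCoprime (r ^ 2 + a * r * s + b * s ^ 2) s := by
      have : r ^ 2 + a * r * s + b * s ^ 2 = r ^ 2 + s * (a * r + b * s) := by ring
      rw [this]
      exact hcop.pow_left.add_mul_left_left _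
    rw [hN] at h1
    exact h1.of_mul_left_left
  have hgr : g ∣ r := hgs.dvd_of_dvd_mul_right (Dvd.intro _ hD.symm)
  have hgb : g ∣ b := by
    refine (hgs.pow_right (n := 2)).dvd_of_dvd_mul_right ?_
    have : b * s ^ 2 = (r ^ 2 + a * r * s + b * s ^ 2) - r * (r + a * s) := by ring
    rw [this]
    exact dvd_sub (Dvd.intro _ hN.symm) (hgr.mul_right _)
  have hg : |g| ≤ |b| := Int.le_of_dvd (abs_pos.mpr hb) ((abs_dvd_abs _ _).mpr hgb)
  have hb1 : 1 ≤ |b| := Int.one_le_abs hb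
  have hNH : |r ^ 2 + a * r * s + b * s ^ 2| ≤ |b| * H := by
    rw [hN, abs_mul]
    gcongr
  have hDH : |r * s| ≤ |b| * H := by
    rw [hD, abs_mul, Nat.abs_cast]
    gcongr
  have haD : |a * (r * s)| ≤ |a| * (|b| * H) := by
    rw [abs_mul]
    gcongr
  have ha0 := abs_nonneg a
  have hrs : |r * s| = |r| * s := by rw [abs_mul, abs_of_pos hs0]
  have hbb : 1 * (|b| * H) ≤ |b| * (|b| * H) := by gcongr
  rw [abs_le] at hNH haD
  refine max_le ?_ ?_
  · rcases le_total |r| s with hle | hle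
    · have : r ^ 2 ≤ |r| * s := by
        rw [← sq_abs]
        nlinarith [abs_nonneg r]
      nlinarith
    · have h1 : s ^ 2 ≤ |b| * H := by nlinarith
      have h2 : |b * s ^ 2| ≤ |b| * (|b| * H) := by
        rw [abs_mul, abs_of_nonneg (sq_nonneg s)]
        gcongr
      rw [abs_le] at h2
      nlinarith
  · rcases le_total |r| s with hle | hle
    · have h1 : r ^ 2 ≤ |b| * H := by
        rw [← sq_abs]
        nlinarith [abs_nonneg r]
      have h2 : s ^ 2 ≤ |b * s ^ 2| := by
        rw [abs_mul, abs_of_nonneg (sq_nonneg s)]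
        nlinarith [sq_nonneg s]
      refine h2.trans (abs_le.mpr ⟨?_, ?_⟩) <;> nlinarith [sq_nonneg r]
    · nlinarith

/-! ### Torsion from division with bounded height -/

lemma exists_nsmul_eq_zero_of_finite {A : Type*} [AddCommGroup A] {S : Set A} (hS : S.Finite)
    (h : ∀ P ∈ S, ∃ R ∈ S, 2 • P = 4 • R) {P : A} (hP : P ∈ S) : ∃ n : ℕ, 0 < n ∧ n • P = 0 := by
  choose! f hf using h
  have hmem : ∀ i, f^[i] P ∈ S := fun i => by
    induction i with
    | zero => exact hP
    | succ i ih => rw [Function.iterate_succ_apply']; exact (hf _ ih).1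
  have hdiv : ∀ i k, 2 • f^[i] P = 2 ^ k • 2 • f^[i + k] P := fun i k => by
    induction k with
    | zero => simp
    | succ k ih =>
      rw [ih, (hf _ (hmem (i + k))).2, ← add_assoc, Function.iterate_succ_apply', smul_smul,
        smul_smul]
      congr 1
      ring
  have hninj : ¬ Function.Injective fun i => f^[i] P := fun hinj =>
    Set.infinite_range_of_injective hinj (hS.subset (Set.range_subset_iff.mpr hmem))
  obtain ⟨i, k, hk, hik⟩ : ∃ i k, 0 < k ∧ f^[i + k] P = f^[i] P := by
    simp only [Function.Injective, not_forall] at hninj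
    obtain ⟨i, j, hij, hne⟩ := hninj
    rcases lt_or_gt_of_ne hne with hlt | hlt
    · exact ⟨i, j - i, by lia, by rw [Nat.add_sub_cancel' hlt.le]; exact hij.symm⟩
    · exact ⟨j, i - j, by lia, by rw [Nat.add_sub_cancel' hlt.le]; exact hij⟩
  have hk2 : 1 < 2 ^ k := Nat.one_lt_two_pow hk.ne'
  have hzero : (2 ^ k - 1) • 2 • f^[i] P = 0 := by
    have := hdiv i k
    rw [hik] at this
    rw [sub_nsmul _ hk2.le, one_nsmul, ← this, add_neg_cancel]
  refine ⟨(2 ^ k - 1) * 2, by lia, ?_⟩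
  have h0 := hdiv 0 i
  rw [zero_add, Function.iterate_zero_apply] at h0
  rw [mul_smul, h0, smul_comm, hzero, smul_zero]

/-! ### Halving points -/

/-- The curve `y² = x(x² - p x - p²)`. -/
def goldenTwist (p : ℕ) : WeierstrassCurve.Affine ℚ :=
  { a₁ := 0, a₂ := -(p : ℚ), a₃ := 0, a₄ := -(p : ℚ) ^ 2, a₆ := 0 }

/-- The coordinates of the points obtained from a point with square abscissa `u²` by lifting along
both isogenies: `v²` is the abscissa on the isogenous curve, `t` that of the half. -/
lemma exists_halving_coordinates {p : ℕ} (hp : p.Prime) (h4 : p % 4 = 3) {u y : ℚ} (hu : u ≠ 0)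
    (h : y ^ 2 = (u ^ 2) ^ 3 - p * (u ^ 2) ^ 2 - p ^ 2 * u ^ 2) :
    ∃ v t : ℚ, v ≠ 0 ∧ t ≠ 0 ∧ 4 * u ^ 2 * v ^ 2 = (v ^ 2) ^ 2 + 2 * p * v ^ 2 + 5 * p ^ 2 ∧
      v ^ 2 * t = t ^ 2 - p * t - p ^ 2 ∧ 2 * t - v ^ 2 - p = 2 * u * v := by
  have hp0 : (p : ℚ) ≠ 0 := by exact_mod_cast hp.ne_zero
  obtain ⟨w, rfl⟩ : ∃ w, y = w * u := ⟨y / u, by field_simp⟩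
  have hw : w ^ 2 = u ^ 4 - p * u ^ 2 - p ^ 2 :=
    mul_right_cancel₀ (pow_ne_zero 2 hu) (by linear_combination h)
  suffices ∃ v : ℚ, v ≠ 0 ∧ 4 * u ^ 2 * v ^ 2 = (v ^ 2) ^ 2 + 2 * p * v ^ 2 + 5 * p ^ 2 by
    obtain ⟨v, hv, hv4⟩ := this
    have ht : v ^ 2 * ((v ^ 2 + p + 2 * u * v) / 2) = ((v ^ 2 + p + 2 * u * v) / 2) ^ 2
        - p * ((v ^ 2 + p + 2 * u * v) / 2) - p ^ 2 := by linear_combination -hv4 / 4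
    refine ⟨v, (v ^ 2 + p + 2 * u * v) / 2, hv, fun h0 => ?_, hv4, ht, by ring⟩
    rw [h0] at ht
    exact hp0 (pow_eq_zero_iff two_ne_zero |>.mp (by linear_combination ht))
  obtain ⟨X, hX⟩ : ∃ X : ℚ, X = -p + 2 * u ^ 2 + 2 * w := ⟨_, rfl⟩
  have hXeq : 4 * u ^ 2 * X = X ^ 2 + 2 * p * X + 5 * p ^ 2 := by
    rw [hX]
    linear_combination -4 * hw
  have hX0 : X ≠ 0 := by
    rintro rfl
    exact hp0 (pow_eq_zero_iff two_ne_zero |>.mp (by linear_combination -hXeq / 5))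
  rcases isSquare_or_isSquare_five_mul_of_equation hp h4 (y := 2 * u * X) hX0
    (by linear_combination X * hXeq) with ⟨v, hv⟩ | ⟨v, hv⟩
  · have hv2 : X = v ^ 2 := by rw [hv, sq]
    exact ⟨v, by rintro rfl; exact hX0 (by simpa using hv), by rw [← hv2, hXeq]⟩
  · have hv0 : v ≠ 0 := by
      rintro rfl
      exact hX0 (by linarith)
    have hXv : X = v ^ 2 / 5 := by linear_combination hv / 5
    rw [hXv] at hXeq
    refine ⟨5 * p / v, by positivity, ?_⟩
    field_simp
    linear_combination 25 * hXeq

namespace goldenTwist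

open WeierstrassCurve.Affine

variable {p : ℕ}

lemma equation_iff {x y : ℚ} :
    (goldenTwist p).Equation x y ↔ y ^ 2 = x ^ 3 - p * x ^ 2 - p ^ 2 * x := by
  rw [WeierstrassCurve.Affine.equation_iff]
  simp only [goldenTwist]
  constructor <;> intro h <;> linear_combination h

lemma nonsingular_of_ne_zero {x y : ℚ} (hy : y ≠ 0)
    (h : y ^ 2 = x ^ 3 - p * x ^ 2 - p ^ 2 * x) : (goldenTwist p).Nonsingular x y := by
  rw [WeierstrassCurve.Affine.nonsingular_iff']
  exact ⟨equation_iff.mpr h, .inr (by simpa [goldenTwist] using hy)⟩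

lemma nonsingular_zero (hp : p ≠ 0) : (goldenTwist p).Nonsingular 0 0 := by
  rw [WeierstrassCurve.Affine.nonsingular_iff']
  exact ⟨equation_iff.mpr (by simp), .inl (by simpa [goldenTwist] using hp)⟩

/-- The rational two-torsion point `(0, 0)`. -/
def torsionPoint (hp : p ≠ 0) : (goldenTwist p).Point := .some 0 0 (nonsingular_zero hp)

lemma two_nsmul_torsionPoint (hp : p ≠ 0) : 2 • torsionPoint hp = 0 := by
  rw [two_nsmul]
  exact Point.add_self_of_Y_eq (by simp [negY, goldenTwist])

lemma eq_or_eq_neg_of_X_eq {W : WeierstrassCurve.Affine ℚ} {x₁ x₂ y₁ y₂ : ℚ}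
    (h₁ : W.Nonsingular x₁ y₁) (h₂ : W.Nonsingular x₂ y₂) (hx : x₁ = x₂) :
    Point.some x₁ y₁ h₁ = Point.some x₂ y₂ h₂ ∨ Point.some x₁ y₁ h₁ = -Point.some x₂ y₂ h₂ := by
  subst hx
  rcases Y_eq_of_X_eq h₁.1 h₂.1 rfl with rfl | rfl
  · exact .inl rfl
  · exact .inr (Point.neg_some h₂).symm

lemma exists_add_torsionPoint (hp : p ≠ 0) {x y : ℚ} (hx : x ≠ 0)
    (h : (goldenTwist p).Nonsingular x y) :
    ∃ y' h', Point.some x y h + torsionPoint hp = Point.some (-p ^ 2 / x) y' h' := by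
  have hX : (goldenTwist p).addX x 0 ((goldenTwist p).slope x 0 y 0) = -p ^ 2 / x := by
    rw [slope_of_X_ne hx, addX]
    simp only [goldenTwist]
    field_simp
    linear_combination x * equation_iff.mp h.1
  rw [torsionPoint, Point.add_of_X_ne hx]
  generalize_proofs hns
  revert hns
  rw [hX]
  exact fun hns => ⟨_, hns, rfl⟩

/-- The height of the abscissa, with value `1` at the point at infinity. -/
def height : (goldenTwist p).Point → ℤ
  | .zero => 1
  | .some x _ _ => ratHeight x

lemma one_le_height (P : (goldenTwist p).Point) : 1 ≤ height P := by
  rcases P with _ | ⟨x, y, h⟩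
  · exact le_rfl
  · exact one_le_ratHeight x

lemma finite_setOf_height_le (B : ℤ) : {P : (goldenTwist p).Point | height P ≤ B}.Finite := by
  have hsub : {P : (goldenTwist p).Point | height P ≤ B} ⊆
      {0} ∪ ⋃ x ∈ {x : ℚ | ratHeight x ≤ B}, {P | ∃ y h, P = Point.some x y h} := by
    rintro (_ | ⟨x, y, h⟩) hP
    · exact .inl rfl
    · exact .inr (Set.mem_biUnion (x := x) hP ⟨y, h, rfl⟩)
  refine Set.Finite.subset ((Set.finite_singleton 0).union
    ((finite_setOf_ratHeight_le B).biUnion fun x _ => ?_)) hsub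
  rcases Set.eq_empty_or_nonempty {P : (goldenTwist p).Point | ∃ y h, P = Point.some x y h} with
    he | ⟨_, y, h, rfl⟩
  · simp [he]
  · refine (Set.toFinite {Point.some x y h, -Point.some x y h}).subset ?_
    rintro _ ⟨y', h', rfl⟩
    exact eq_or_eq_neg_of_X_eq h' h rfl

/-- A factor by which fourth powers of heights of halves are bounded. -/
def halvingConstant (p : ℕ) : ℤ :=
  ((2 + |-(p : ℤ)| + |-(p : ℤ) ^ 2|) * |-(p : ℤ) ^ 2|) ^ 2 *
    ((2 + |2 * (p : ℤ)| + |5 * (p : ℤ) ^ 2|) * |5 * (p : ℤ) ^ 2|) * 4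

lemma halvingConstant_pos (hp : p ≠ 0) : 0 < halvingConstant p := by
  have : (0 : ℤ) < p := by positivity
  have h1 : 0 < |-(p : ℤ) ^ 2| := by rw [abs_neg]; positivity
  unfold halvingConstant
  positivity

lemma ratHeight_pow_four_le (hp : p ≠ 0) {u v t : ℚ} (hv : v ≠ 0) (ht : t ≠ 0)
    (h₁ : 4 * u ^ 2 * v ^ 2 = (v ^ 2) ^ 2 + 2 * p * v ^ 2 + 5 * p ^ 2)
    (h₂ : v ^ 2 * t = t ^ 2 - p * t - p ^ 2) :
    ratHeight t ^ 4 ≤ halvingConstant p * ratHeight (u ^ 2) := by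
  have hpz : (p : ℤ) ≠ 0 := by exact_mod_cast hp
  have e₂ := ratHeight_sq_le (a := -p) (b := -p ^ 2) (by simpa using hp) ht
    (z := v ^ 2) (by push_cast; linear_combination h₂)
  have e₁ := ratHeight_sq_le (a := 2 * p) (b := 5 * p ^ 2) (by positivity) (pow_ne_zero 2 hv)
    (z := 4 * u ^ 2) (by push_cast; linear_combination h₁)
  have e₀ : ratHeight (4 * u ^ 2) ≤ 4 * ratHeight (u ^ 2) :=
    ratHeight_intCast_mul_le (c := 4) (by norm_num) (u ^ 2)
  unfold halvingConstant
  set C₂ := (2 + |-(p : ℤ)| + |-(p : ℤ) ^ 2|) * |-(p : ℤ) ^ 2|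
  set C₁ := (2 + |2 * (p : ℤ)| + |5 * (p : ℤ) ^ 2|) * |5 * (p : ℤ) ^ 2|
  have hC₁ : 0 ≤ C₁ := by positivity
  calc ratHeight t ^ 4 = (ratHeight t ^ 2) ^ 2 := by ring
    _ ≤ (C₂ * ratHeight (v ^ 2)) ^ 2 := by gcongr
    _ = C₂ ^ 2 * ratHeight (v ^ 2) ^ 2 := by ring
    _ ≤ C₂ ^ 2 * (C₁ * (4 * ratHeight (u ^ 2))) := by
      gcongr
      exact e₁.trans (by gcongr)
    _ = C₂ ^ 2 * C₁ * 4 * ratHeight (u ^ 2) := by ring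

lemma height_neg (P : (goldenTwist p).Point) : height (-P) = height P := by
  rcases P with _ | ⟨x, y, h⟩ <;> rfl

/-- A point with square nonzero abscissa is twice a point. -/
lemma exists_two_nsmul_eq (hp : p.Prime) (h4 : p % 4 = 3) {u y : ℚ} (hu : u ≠ 0)
    (h : (goldenTwist p).Nonsingular (u ^ 2) y) :
    ∃ R, Point.some (u ^ 2) y h = 2 • R ∧
      height R ^ 4 ≤ halvingConstant p * ratHeight (u ^ 2) := by
  obtain ⟨v, t, hv, ht, h₁, h₂, h₃⟩ := exists_halving_coordinates hp h4 hu (equation_iff.mp h.1)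
  have hvt : v * t ≠ 0 := mul_ne_zero hv ht
  have hR := nonsingular_of_ne_zero (p := p) (x := t) hvt (by linear_combination t * h₂)
  have hheight : height (.some t (v * t) hR) ^ 4 ≤ _ :=
    ratHeight_pow_four_le hp.ne_zero hv ht h₁ h₂
  have hY : v * t ≠ (goldenTwist p).negY t (v * t) := by
    simp only [negY, goldenTwist]
    intro h0
    exact hvt (by linarith)
  have hX : (goldenTwist p).addX t t ((goldenTwist p).slope t t (v * t) (v * t)) = u ^ 2 := by
    have hs : (goldenTwist p).slope t t (v * t) (v * t) = u + v := by
      rw [slope_of_Y_ne rfl hY, div_eq_iff (sub_ne_zero.mpr hY)]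
      simp only [negY, goldenTwist]
      linear_combination t * h₃ - h₂
    rw [hs, addX]
    simp only [goldenTwist]
    linear_combination -h₃
  have hdouble := Point.add_self_of_Y_ne (h₁ := hR) hY
  rw [← two_nsmul] at hdouble
  rcases eq_or_eq_neg_of_X_eq h (nonsingular_add hR hR fun hxy => hY hxy.2) hX.symm with
    heq | heq
  · exact ⟨_, heq.trans hdouble.symm, hheight⟩
  · exact ⟨-Point.some t (v * t) hR, heq.trans (by rw [← hdouble, neg_nsmul]), by rwa [height_neg]⟩

lemma exists_two_nsmul_eq_four_nsmul (hp : p.Prime) (h4 : p % 4 = 3)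
    (h5 : p % 5 = 2 ∨ p % 5 = 3) (P : (goldenTwist p).Point) :
    ∃ R, 2 • P = 4 • R ∧ height R ^ 4 ≤ halvingConstant p * p ^ 2 * height P := by
  have hC := halvingConstant_pos hp.ne_zero
  have hp1 : (1 : ℤ) ≤ p ^ 2 := one_le_pow₀ (by exact_mod_cast hp.one_le)
  have hzero : height (0 : (goldenTwist p).Point) ^ 4 ≤ halvingConstant p * p ^ 2 * height P := by
    have h0 : height (0 : (goldenTwist p).Point) = 1 := rfl
    have := one_le_height P
    rw [h0, one_pow]
    exact one_le_mul_of_one_le_of_one_le (one_le_mul_of_one_le_of_one_le hC hp1) this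
  rcases P with _ | ⟨x, y, h⟩
  · exact ⟨0, by rw [← Point.zero_def]; simp, hzero⟩
  by_cases hx : x = 0
  · subst hx
    obtain rfl : y = 0 := by simpa using equation_iff.mp h.1
    exact ⟨0, (two_nsmul_torsionPoint hp.ne_zero).trans (by simp), hzero⟩
  rcases isSquare_or_isSquare_neg_of_equation hp h4 h5 (equation_iff.mp h.1) with
    ⟨u, hu⟩ | ⟨u, hu⟩
  · obtain rfl : x = u ^ 2 := by rw [hu, sq]
    obtain ⟨R, hPR, hR⟩ := exists_two_nsmul_eq hp h4 (by simpa using hx) h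
    refine ⟨R, by rw [hPR, ← mul_smul]; norm_num, hR.trans ?_⟩
    have := one_le_ratHeight (u ^ 2)
    rw [height, mul_assoc]
    gcongr
    exact le_mul_of_one_le_left (by linarith) hp1
  · have hu0 : u ≠ 0 := by
      rintro rfl
      exact hx (by simpa using hu)
    have hp0 : (p : ℚ) ≠ 0 := by exact_mod_cast hp.ne_zero
    obtain ⟨y', h', hadd⟩ := exists_add_torsionPoint hp.ne_zero hx h
    have hxu : -(p : ℚ) ^ 2 / x = (p / u) ^ 2 := by
      have : x = -u ^ 2 := by linear_combination -hu
      rw [this]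
      field_simp
    have hle : ratHeight ((p / u) ^ 2) ≤ p ^ 2 * ratHeight x := by
      rw [← hxu, div_eq_mul_inv]
      have := ratHeight_intCast_mul_le (c := -p ^ 2) (by simpa using hp.ne_zero) x⁻¹
      rw [abs_neg, abs_of_pos (by linarith)] at this
      push_cast at this
      refine this.trans ?_
      gcongr
      exact ratHeight_inv_le hx
    revert h'
    rw [hxu]
    intro h' hadd
    obtain ⟨R, hPR, hR⟩ := exists_two_nsmul_eq hp h4 (div_ne_zero hp0 hu0) h'
    refine ⟨R, ?_, hR.trans ?_⟩
    · calc 2 • Point.some x y h = 2 • (Point.some x y h + torsionPoint hp.ne_zero) := by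
            rw [nsmul_add, two_nsmul_torsionPoint, add_zero]
        _ = 4 • R := by
            rw [hadd, hPR, ← mul_smul]
            norm_num
    · rw [height, mul_assoc]
      gcongr

/-- Every rational point is torsion. -/
theorem exists_nsmul_eq_zero (hp : p.Prime) (h4 : p % 4 = 3) (h5 : p % 5 = 2 ∨ p % 5 = 3)
    (P : (goldenTwist p).Point) : ∃ n : ℕ, 0 < n ∧ n • P = 0 := by
  set C := halvingConstant p * p ^ 2
  refine exists_nsmul_eq_zero_of_finite (finite_setOf_height_le (max (height P) C))
    (fun Q hQ => ?_) (le_max_left (height P) C)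
  obtain ⟨R, hQR, hR⟩ := exists_two_nsmul_eq_four_nsmul hp h4 h5 Q
  refine ⟨R, ?_, hQR⟩
  by_contra hlt
  change ¬ height R ≤ max (height P) C at hlt
  obtain ⟨hPR, hC⟩ := max_lt_iff.mp (not_le.mp hlt)
  have h1 := one_le_height Q
  have hQR' : height Q < height R := hQ.trans_lt (max_lt hPR hC)
  have hlt2 : C * height Q < height R * height R :=
    calc C * height Q ≤ height R * height Q := by gcongr
      _ < height R * height R := by gcongr; linarith
  have hpow : height R ^ 2 ≤ height R ^ 4 := pow_le_pow_right₀ (by linarith) (by norm_num)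
  rw [sq] at hpow
  exact absurd (hpow.trans hR) (not_le.mpr hlt2)

end goldenTwist

/-! ### Square classes -/

lemma sqClass_eq_of_isSquare_mul {x y : ℚ} (hx : x ≠ 0) (hy : y ≠ 0) (h : IsSquare (x * y)) :
    sqClass x = sqClass y := by
  obtain ⟨w, hw⟩ := h
  have hw0 : w ≠ 0 := by
    rintro rfl
    exact mul_ne_zero hx hy (by simpa using hw)
  rw [sqClass, sqClass, dif_neg hx, dif_neg hy, QuotientGroup.eq]
  refine ⟨Units.mk0 (w / x) (div_ne_zero hw0 hx), Units.ext ?_⟩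
  simp only [powMonoidHom_apply, Units.val_pow_eq_pow_val, Units.val_mk0, Units.val_mul,
    Units.val_inv_eq_inv_val]
  field_simp
  linear_combination -hw

lemma sqClass_one : sqClass 1 = 1 := by
  rw [sqClass, dif_neg one_ne_zero, Units.mk0_one, QuotientGroup.mk_one]

lemma isSquare_of_sqClass_eq_one {x : ℚ} (hx : x ≠ 0) (h : sqClass x = 1) : IsSquare x := by
  rw [sqClass, dif_neg hx, QuotientGroup.eq_one_iff] at h
  obtain ⟨u, hu⟩ := h
  refine ⟨u, ?_⟩
  have := congrArg Units.val hu
  simpa [sq] using this.symm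

lemma ncard_eq_two_of_isSquare_or_isSquare_mul {d : ℚ} (hd : ¬ IsSquare d) {S : Set (ℚˣ ⧸ QSq)}
    (hone : 1 ∈ S) (hdS : sqClass d ∈ S)
    (hS : ∀ c ∈ S, c = 1 ∨ c = sqClass d ∨
      ∃ x ≠ 0, c = sqClass x ∧ (IsSquare x ∨ IsSquare (d * x))) : S.ncard = 2 := by
  have hd0 : d ≠ 0 := by
    rintro rfl
    exact hd IsSquare.zero
  have heq : S = {1, sqClass d} := by
    refine Set.Subset.antisymm (fun c hc => ?_) ?_
    · obtain rfl | rfl | ⟨x, hx, rfl, h | h⟩ := hS c hc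
      · exact .inl rfl
      · exact .inr rfl
      · exact .inl (sqClass_one ▸ sqClass_eq_of_isSquare_mul hx one_ne_zero (by simpa using h))
      · exact .inr (sqClass_eq_of_isSquare_mul hd0 hx h).symm
    · rintro c (rfl | rfl)
      · exact hone
      · exact hdS
  rw [heq]
  exact Set.ncard_pair fun h => hd (isSquare_of_sqClass_eq_one hd0 h.symm)

/-- For `p ≡ 3 (mod 4)` with `p ≡ ±2 (mod 5)`, the descent images for the
2-isogenous pair `E₋ₚ : y² = x(x² - px - p²)` and `E′₋ₚ : y² = x(x² + 2px + 5p²)`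
each have exactly 2 elements, and `E₋ₚ(ℚ)` has Mordell–Weil rank 0
(every rational point is torsion). -/
theorem stmt_19 (p : ℕ) (hp : Nat.Prime p) (h4 : p % 4 = 3) (h5 : p % 5 = 2 ∨ p % 5 = 3)
    (E : WeierstrassCurve.Affine ℚ)
    (hE : E = { a₁ := 0, a₂ := -(p : ℚ), a₃ := 0, a₄ := -(p : ℚ) ^ 2, a₆ := 0 })
    (imφ imφ' : Set (ℚˣ ⧸ QSq))
    (himφ : imφ = {c | c = 1 ∨ c = sqClass (5 * (p : ℚ) ^ 2) ∨
      ∃ x y : ℚ, x ≠ 0 ∧ y ^ 2 = x ^ 3 + 2 * (p : ℚ) * x ^ 2 + 5 * (p : ℚ) ^ 2 * x ∧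
        c = sqClass x})
    (himφ' : imφ' = {c | c = 1 ∨ c = sqClass (-(p : ℚ) ^ 2) ∨
      ∃ x y : ℚ, x ≠ 0 ∧ y ^ 2 = x ^ 3 - (p : ℚ) * x ^ 2 - (p : ℚ) ^ 2 * x ∧
        c = sqClass x}) :
    imφ.ncard = 2 ∧ imφ'.ncard = 2 ∧
      ∀ P : E.Point, ∃ n : ℕ, 0 < n ∧ n • P = 0 := by
  have hp0 : (p : ℚ) ≠ 0 := by exact_mod_cast hp.ne_zero
  subst hE himφ himφ'
  refine ⟨?_, ?_, goldenTwist.exists_nsmul_eq_zero hp h4 h5⟩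
  · refine ncard_eq_two_of_isSquare_or_isSquare_mul (d := 5 * (p : ℚ) ^ 2) ?_ (.inl rfl)
      (.inr (.inl rfl)) ?_
    · rintro ⟨w, hw⟩
      have h5sq : IsSquare ((5 : ℤ) : ℚ) := ⟨w / p, by push_cast; field_simp; linarith⟩
      rw [Rat.isSquare_intCast_iff] at h5sq
      exact (Int.prime_iff_natAbs_prime.mpr (by norm_num)).irreducible.not_isSquare h5sq
    · rintro c (h | h | ⟨x, y, hx, hxy, rfl⟩)
      · exact .inl h
      · exact .inr (.inl h)
      · refine .inr (.inr ⟨x, hx, rfl, ?_⟩)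
        refine (isSquare_or_isSquare_five_mul_of_equation hp h4 hx hxy).imp_right fun hsq => ?_
        rw [mul_right_comm]
        exact hsq.mul (IsSquare.sq _)
  · refine ncard_eq_two_of_isSquare_or_isSquare_mul (d := -(p : ℚ) ^ 2) ?_ (.inl rfl)
      (.inr (.inl rfl)) ?_
    · intro hsq
      have := hsq.nonneg
      have : 0 < (p : ℚ) ^ 2 := by positivity
      linarith
    · rintro c (h | h | ⟨x, y, hx, hxy, rfl⟩)
      · exact .inl h
      · exact .inr (.inl h)
      · refine .inr (.inr ⟨x, hx, rfl, ?_⟩)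
        refine (isSquare_or_isSquare_neg_of_equation hp h4 h5 hxy).imp_right fun hsq => ?_
        rw [neg_mul_comm, mul_comm]
        exact hsq.mul (IsSquare.sq _)
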